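/- Let A and B be n×n positive definite complex matrices and s ∈ [0,1]. Then ‖((1−s)/2)(A + B) + s(A♯B)‖₂ ≤ ‖((1−s)/2)(A + B) + s A^{1/2} B^{1/2}‖₂, where ‖X‖₂ = (Tr(X*X))^{1/2} is the Hilbert–Schmidt (Frobenius) norm, X* denotes the conjugate transpose, and A♯B = A♯_{1/2}B is the geometric mean. -/

import Mathlib

open Matrix ComplexOrder

/-- Real power of a Hermitian matrix via the functional calculus (spectral decomposition). -/
noncomputable def mpow {n : ℕ} (A : Matrix (Fin n) (Fin n) ℂ) (r : ℝ) :
    Matrix (Fin n) (Fin n) ℂ :=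
  if hA : A.IsHermitian then
    (hA.eigenvectorUnitary : Matrix (Fin n) (Fin n) ℂ) *
      Matrix.diagonal (fun i => ((hA.eigenvalues i ^ r : ℝ) : ℂ)) *
      (star hA.eigenvectorUnitary : Matrix (Fin n) (Fin n) ℂ)
  else 0

/-- The t-geometric mean `A ♯ₜ B = A^{1/2} (A^{-1/2} B A^{-1/2})^t A^{1/2}`. -/
noncomputable def geomMean {n : ℕ} (A B : Matrix (Fin n) (Fin n) ℂ) (t : ℝ) :
    Matrix (Fin n) (Fin n) ℂ :=
  mpow A (1/2) * mpow (mpow A (-(1/2)) * B * mpow A (-(1/2))) t * mpow A (1/2)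

/-- Eigenvalues of a Hermitian matrix in decreasing order. -/
noncomputable def eigsDesc {n : ℕ} (M : Matrix (Fin n) (Fin n) ℂ) : Fin n → ℝ :=
  if hM : M.IsHermitian then fun i => hM.eigenvalues (Tuple.sort hM.eigenvalues (Fin.rev i))
  else 0

/-- The trace norm ‖X‖₁ = Tr((X*X)^{1/2}). -/
noncomputable def traceNorm {n : ℕ} (X : Matrix (Fin n) (Fin n) ℂ) : ℝ :=
  ((mpow (Xᴴ * X) (1/2)).trace).re

/-- The Hilbert–Schmidt (Frobenius) norm ‖X‖₂ = (Tr(X*X))^{1/2}. -/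
noncomputable def hsNorm {n : ℕ} (X : Matrix (Fin n) (Fin n) ℂ) : ℝ :=
  Real.sqrt ((Xᴴ * X).trace.re)

lemma Finset.sum_mul_nonneg_of_superlevel {ι : Type*} (s : Finset ι) (w f : ι → ℝ)
    (hw : ∀ i ∈ s, 0 ≤ w i) (h : ∀ j ∈ s, 0 ≤ ∑ i ∈ s with w j ≤ w i, f i) :
    0 ≤ ∑ i ∈ s, w i * f i := by
  classical
  induction s using Finset.strongInduction generalizing w with
  | H s ih =>
    rcases s.eq_empty_or_nonempty with rfl | hne
    · simp
    obtain ⟨m, hm, hmin⟩ := s.exists_min_image w hne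
    have hsub : s.filter (fun i => w m < w i) ⊂ s :=
      Finset.filter_ssubset.2 ⟨m, hm, lt_irrefl _⟩
    have hrec : 0 ≤ ∑ i ∈ s with w m < w i, (w i - w m) * f i := by
      refine ih _ hsub (fun i => w i - w m) (fun i hi => ?_) (fun j hj => ?_)
      · exact sub_nonneg.2 (Finset.mem_filter.1 hi).2.le
      · obtain ⟨hjs, hj⟩ := Finset.mem_filter.1 hj
        convert h j hjs using 2
        ext i
        simp only [Finset.mem_filter, sub_le_sub_iff_right, and_assoc]
        exact and_congr_right fun _ => ⟨fun h => h.2, fun h => ⟨hj.trans_le h, h⟩⟩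
    have htot : 0 ≤ ∑ i ∈ s, f i := by
      have := h m hm
      rwa [Finset.filter_true_of_mem hmin] at this
    have hsplit : ∑ i ∈ s, w i * f i
        = w m * ∑ i ∈ s, f i + ∑ i ∈ s with w m < w i, (w i - w m) * f i := by
      rw [Finset.sum_filter, Finset.mul_sum, ← Finset.sum_add_distrib]
      refine Finset.sum_congr rfl fun i hi => ?_
      split_ifs with hlt
      · ring
      · rw [le_antisymm (not_lt.1 hlt) (hmin i hi)]; ring
    rw [hsplit]
    exact add_nonneg (mul_nonneg (hw m hm) htot) hrec

section
variable {n : ℕ} {A B G X Y P Q : Matrix (Fin n) (Fin n) ℂ}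

lemma mpow_eq (hA : A.IsHermitian) (r : ℝ) :
    mpow A r = (hA.eigenvectorUnitary : Matrix (Fin n) (Fin n) ℂ) *
      Matrix.diagonal (fun i => ((hA.eigenvalues i ^ r : ℝ) : ℂ)) *
      (hA.eigenvectorUnitary : Matrix (Fin n) (Fin n) ℂ)ᴴ := by
  rw [mpow, dif_pos hA]; rfl

lemma mpow_mul_mpow (hA : A.PosDef) (r s : ℝ) : mpow A r * mpow A s = mpow A (r + s) := by
  have hU : (hA.1.eigenvectorUnitary : Matrix (Fin n) (Fin n) ℂ)ᴴ *
      (hA.1.eigenvectorUnitary : Matrix (Fin n) (Fin n) ℂ) = 1 :=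
    Unitary.coe_star_mul_self hA.1.eigenvectorUnitary
  simp only [mpow_eq hA.1]
  generalize (hA.1.eigenvectorUnitary : Matrix (Fin n) (Fin n) ℂ) = U at hU ⊢
  simp only [Real.rpow_add (hA.eigenvalues_pos _), Complex.ofReal_mul, ← diagonal_mul_diagonal]
  simp only [Matrix.mul_assoc]
  rw [← Matrix.mul_assoc Uᴴ U, hU, Matrix.one_mul]

lemma mpow_one (hA : A.PosDef) : mpow A 1 = A := by
  conv_rhs => rw [hA.1.spectral_theorem]
  simp only [mpow_eq hA.1, Real.rpow_one]
  rfl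

lemma mpow_zero (hA : A.PosDef) : mpow A 0 = 1 := by
  simp only [mpow_eq hA.1, Real.rpow_zero, Complex.ofReal_one, diagonal_one, Matrix.mul_one]
  exact Unitary.coe_mul_star_self hA.1.eigenvectorUnitary

lemma mpow_posDef (hA : A.PosDef) (r : ℝ) : (mpow A r).PosDef := by
  rw [mpow_eq hA.1]
  refine PosDef.mul_mul_conjTranspose_same (PosDef.diagonal fun i => ?_) ?_
  · exact_mod_cast Real.rpow_pos_of_pos (hA.eigenvalues_pos i) r
  · exact Matrix.vecMul_injective_of_isUnit (Unitary.toUnits hA.1.eigenvectorUnitary).isUnit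

lemma mpow_half_mul_self (hA : A.PosDef) : mpow A (1/2) * mpow A (1/2) = A := by
  rw [mpow_mul_mpow hA, add_halves, mpow_one hA]

/-- The square root is operator monotone. -/
lemma posSemidef_sub_of_sq (hP : P.PosSemidef) (hQ : Q.PosDef)
    (h : (Q * Q - P * P).PosSemidef) : (Q - P).PosSemidef := by
  have hD : (Q - P).IsHermitian := hQ.1.sub hP.1
  rw [hD.posSemidef_iff_eigenvalues_nonneg]
  intro i
  by_contra hlt
  simp only [Pi.zero_apply, not_le] at hlt
  set v : Fin n → ℂ := ⇑(hD.eigenvectorBasis i)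
  set l := hD.eigenvalues i
  have hev : (Q - P) *ᵥ v = (l : ℂ) • v := by
    have := hD.mulVec_eigenvectorBasis i
    simpa using this
  have hv0 : v ≠ 0 := by
    intro h0
    exact hD.eigenvectorBasis.orthonormal.ne_zero i (by ext j; simpa using congrFun h0 j)
  have hev' : star v ᵥ* (Q - P) = (l : ℂ) • star v := by
    have := congrArg star hev
    rw [star_mulVec, hD.eq] at this
    simpa using this
  have hpos : 0 < (star v ⬝ᵥ ((Q + P) *ᵥ v)).re :=
    (hQ.add_posSemidef hP).re_dotProduct_pos hv0
  have h1 : star v ⬝ᵥ (((Q - P) * (Q + P)) *ᵥ v) = l * (star v ⬝ᵥ ((Q + P) *ᵥ v)) := by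
    rw [← mulVec_mulVec, dotProduct_mulVec, hev', smul_dotProduct, smul_eq_mul]
  have h2 : star v ⬝ᵥ (((Q + P) * (Q - P)) *ᵥ v) = l * (star v ⬝ᵥ ((Q + P) *ᵥ v)) := by
    rw [← mulVec_mulVec, hev, mulVec_smul, dotProduct_smul, smul_eq_mul]
  have h3 : (Q - P) * (Q + P) + (Q + P) * (Q - P) = (Q * Q - P * P) + (Q * Q - P * P) := by
    noncomm_ring
  have h4 := h.re_dotProduct_nonneg v
  have h5 := congrArg (fun M => (star v ⬝ᵥ (M *ᵥ v)).re) h3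
  simp only [add_mulVec, dotProduct_add, h1, h2, Complex.add_re, Complex.re_ofReal_mul] at h5
  simp only [RCLike.re_to_complex] at h4
  rw [add_mulVec, dotProduct_add, Complex.add_re] at hpos
  nlinarith

/-- The trace of a product is at most the trace of the absolute value. -/
lemma re_trace_le_of_mul_conjTranspose_eq_sq {M : Matrix (Fin n) (Fin n) ℂ} (hP : P.PosDef)
    (h : M * Mᴴ = P * P) : M.trace.re ≤ P.trace.re := by
  have hdet : IsUnit P.det := (isUnit_iff_isUnit_det P).1 hP.isUnit
  have hM : P * (P⁻¹ * M) = M := mul_nonsing_inv_cancel_left P M hdet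
  set V := P⁻¹ * M with hV
  have hVV : V * Vᴴ = 1 := by
    rw [hV, conjTranspose_mul, conjTranspose_nonsing_inv, hP.1.eq, Matrix.mul_assoc,
      ← Matrix.mul_assoc M, h]
    rw [Matrix.mul_assoc, mul_nonsing_inv P hdet, Matrix.mul_one, nonsing_inv_mul P hdet]
  have h0 := (hP.posSemidef.conjTranspose_mul_mul_same (1 - V)).trace_nonneg
  have h1 : ((1 - V)ᴴ * P * (1 - V)).trace = P.trace + P.trace - (M.trace + star M.trace) := by
    have e1 : (1 - V)ᴴ * P * (1 - V) = P - P * V - Vᴴ * P + Vᴴ * P * V := by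
      rw [conjTranspose_sub, conjTranspose_one]; noncomm_ring
    have e2 : (Vᴴ * P * V).trace = P.trace := by
      rw [trace_mul_comm, ← Matrix.mul_assoc, hVV, Matrix.one_mul]
    have e3 : (Vᴴ * P).trace = star M.trace := by
      rw [← trace_conjTranspose, ← congrArg conjTranspose hM, conjTranspose_mul P V, hP.1.eq]
    rw [e1, trace_add, trace_sub, trace_sub, e2, e3, hM]; ring
  rw [h1] at h0
  have := (Complex.le_def.1 h0).1
  simp at this
  linarith

lemma re_trace_mul_self_le (Z : Matrix (Fin n) (Fin n) ℂ) :
    (Z * Z).trace.re ≤ (Zᴴ * Z).trace.re := by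
  have h0 := (posSemidef_conjTranspose_mul_self (Z - Zᴴ)).trace_nonneg
  have h1 : ((Z - Zᴴ)ᴴ * (Z - Zᴴ)).trace
      = (Zᴴ * Z).trace + (Zᴴ * Z).trace - ((Z * Z).trace + star (Z * Z).trace) := by
    have e1 : (Z - Zᴴ)ᴴ * (Z - Zᴴ) = Zᴴ * Z - Zᴴ * Zᴴ - Z * Z + Z * Zᴴ := by
      rw [conjTranspose_sub, conjTranspose_conjTranspose]; noncomm_ring
    rw [e1, trace_add, trace_sub, trace_sub, trace_mul_comm Z Zᴴ, ← trace_conjTranspose,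
      conjTranspose_mul]
    ring
  rw [h1] at h0
  have := (Complex.le_def.1 h0).1
  simp at this
  linarith

lemma posDef_diagonal_ofReal {d : Fin n → ℝ} (hd : ∀ i, 0 < d i) :
    (diagonal fun i => (d i : ℂ)).PosDef :=
  PosDef.diagonal fun i => by exact_mod_cast hd i

lemma sum_superlevel_nonneg {x : Fin n → ℝ} (hx : ∀ i, 0 < x i) (hY : Y.PosDef) (hG : G.PosDef)
    (h : Y * Y = G * diagonal (fun i => (((x i)⁻¹ * (x i)⁻¹ : ℝ) : ℂ)) * G) {c : ℝ} (hc : 0 < c) :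
    0 ≤ ∑ i with c ≤ x i, ((Y i i).re - (x i)⁻¹ * (G i i).re) := by
  set z : Fin n → ℝ := fun i => max (x i) c with hz
  have hz0 : ∀ i, 0 < z i := fun i => lt_max_of_lt_right hc
  set D : Matrix (Fin n) (Fin n) ℂ := diagonal (fun i => (((z i)⁻¹ * (z i)⁻¹ : ℝ) : ℂ)) with hD
  have hGDG : (G * D * G).PosDef := by
    have := (posDef_diagonal_ofReal (d := fun i => (z i)⁻¹ * (z i)⁻¹)
      fun i => by have := hz0 i; positivity).mul_mul_conjTranspose_same
      (Matrix.vecMul_injective_of_isUnit hG.isUnit)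
    rwa [hG.1.eq] at this
  set R := mpow (G * D * G) (1/2) with hR
  have hRp : R.PosDef := mpow_posDef hGDG _
  have hRR : R * R = G * D * G := mpow_half_mul_self hGDG
  have hRY : (Y - R).PosSemidef := by
    refine posSemidef_sub_of_sq hRp.posSemidef hY ?_
    rw [h, hRR, ← Matrix.sub_mul, ← Matrix.mul_sub, hD, diagonal_sub]
    have := (PosSemidef.diagonal (d := fun i => (((x i)⁻¹ * (x i)⁻¹ : ℝ) : ℂ)
      - (((z i)⁻¹ * (z i)⁻¹ : ℝ) : ℂ)) ?_).mul_mul_conjTranspose_same G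
    · rwa [hG.1.eq] at this
    · intro i
      have h1 : (z i)⁻¹ ≤ (x i)⁻¹ := inv_anti₀ (hx i) (le_max_left _ _)
      have h2 : 0 ≤ (z i)⁻¹ := (inv_pos.2 (hz0 i)).le
      have h3 : 0 ≤ (x i)⁻¹ * (x i)⁻¹ - (z i)⁻¹ * (z i)⁻¹ := by nlinarith
      simpa using (by exact_mod_cast h3 : (0 : ℂ) ≤
        (((x i)⁻¹ * (x i)⁻¹ - (z i)⁻¹ * (z i)⁻¹ : ℝ) : ℂ))
  have hRG : (c⁻¹ • G - R).PosSemidef := by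
    refine posSemidef_sub_of_sq hRp.posSemidef (hG.smul (inv_pos.2 hc)) ?_
    have e : c⁻¹ • G * c⁻¹ • G - R * R
        = G * diagonal (fun i => ((c⁻¹ * c⁻¹ - (z i)⁻¹ * (z i)⁻¹ : ℝ) : ℂ)) * Gᴴ := by
      have e1 : diagonal (fun i => ((c⁻¹ * c⁻¹ - (z i)⁻¹ * (z i)⁻¹ : ℝ) : ℂ))
          = (c⁻¹ * c⁻¹) • (1 : Matrix (Fin n) (Fin n) ℂ) - D := by
        rw [hD, ← diagonal_one, ← diagonal_smul, diagonal_sub]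
        congr 1
        ext i
        simp
      rw [e1, hRR, hG.1.eq, Matrix.mul_sub, Matrix.sub_mul]
      simp [smul_smul]
    rw [e]
    refine (PosSemidef.diagonal fun i => ?_).mul_mul_conjTranspose_same G
    have h1 : (z i)⁻¹ ≤ c⁻¹ := inv_anti₀ hc (le_max_right _ _)
    have h2 : 0 ≤ (z i)⁻¹ := (inv_pos.2 (hz0 i)).le
    have h3 : 0 ≤ c⁻¹ * c⁻¹ - (z i)⁻¹ * (z i)⁻¹ := by nlinarith
    exact Complex.zero_le_real.2 h3
  have htr : (G * diagonal (fun i => (((z i)⁻¹ : ℝ) : ℂ))).trace.re ≤ R.trace.re := by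
    refine re_trace_le_of_mul_conjTranspose_eq_sq hRp ?_
    rw [hRR, conjTranspose_mul, hG.1.eq, diagonal_conjTranspose, Matrix.mul_assoc,
      ← Matrix.mul_assoc (diagonal _), diagonal_mul_diagonal, Matrix.mul_assoc, hD]
    congr 3
    ext i
    simp
  have htr' : ∑ i, (z i)⁻¹ * (G i i).re ≤ ∑ i, (R i i).re := by
    simp only [trace, diag_apply, mul_diagonal, Complex.re_sum, Complex.re_mul_ofReal] at htr
    simpa only [mul_comm] using htr
  have hYd : ∀ i, (R i i).re ≤ (Y i i).re := fun i => by
    have := (Complex.le_def.1 (hRY.diag_nonneg (i := i))).1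
    simpa using this
  have hGd : ∀ i, (R i i).re ≤ c⁻¹ * (G i i).re := fun i => by
    have := (Complex.le_def.1 (hRG.diag_nonneg (i := i))).1
    simpa using this
  have hterm : ∀ i, (R i i).re - (z i)⁻¹ * (G i i).re
      ≤ if c ≤ x i then (Y i i).re - (x i)⁻¹ * (G i i).re else 0 := by
    intro i
    split_ifs with hi
    · rw [hz]; simp only [max_eq_left hi]; linarith [hYd i]
    · rw [hz]; simp only [max_eq_right (not_le.1 hi).le]; linarith [hGd i]
  rw [Finset.sum_filter]
  refine le_trans ?_ (Finset.sum_le_sum fun i _ => hterm i)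
  rw [Finset.sum_sub_distrib]
  linarith

lemma sum_sq_mul_diag_le {x : Fin n → ℝ} (hx : ∀ i, 0 < x i) (hY : Y.PosDef) (hG : G.PosDef)
    (h : Y * Y = G * diagonal (fun i => (((x i)⁻¹ * (x i)⁻¹ : ℝ) : ℂ)) * G) :
    ∑ i, x i ^ 2 * (G i i).re ≤ ∑ i, x i ^ 3 * (Y i i).re := by
  have := Finset.sum_mul_nonneg_of_superlevel Finset.univ (fun i => x i ^ 3)
    (fun i => (Y i i).re - (x i)⁻¹ * (G i i).re) (fun i _ => (pow_pos (hx i) 3).le) ?_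
  · rw [← sub_nonneg, ← Finset.sum_sub_distrib]
    convert this using 2 with i
    have := (hx i).ne'
    field_simp
  · intro j _
    simp only [pow_le_pow_iff_left₀ (hx _).le (hx _).le three_ne_zero]
    exact sum_superlevel_nonneg hx hY hG h (hx j)

lemma re_trace_sq_mul_le (hX : X.PosDef) (hY : Y.PosDef) (hG : G.PosDef)
    (h : Y * Y = G * (X⁻¹ * X⁻¹) * G) :
    (X * X * G).trace.re ≤ (X * X * X * Y).trace.re := by
  set U : Matrix (Fin n) (Fin n) ℂ := hX.1.eigenvectorUnitary.1
  have hU : Uᴴ * U = 1 := Unitary.coe_star_mul_self hX.1.eigenvectorUnitary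
  have hU' : U * Uᴴ = 1 := Unitary.coe_mul_star_self hX.1.eigenvectorUnitary
  have hUu : IsUnit U := (Unitary.toUnits hX.1.eigenvectorUnitary).isUnit
  set x := hX.1.eigenvalues
  have hx : ∀ i, 0 < x i := hX.eigenvalues_pos
  set D : Matrix (Fin n) (Fin n) ℂ := diagonal (fun i => (x i : ℂ)) with hD
  set E : Matrix (Fin n) (Fin n) ℂ := diagonal (fun i => (((x i)⁻¹ : ℝ) : ℂ)) with hE
  have hXD : X = U * D * Uᴴ := hX.1.spectral_theorem
  have hDE : D * E = 1 := by
    rw [hD, hE, diagonal_mul_diagonal, ← diagonal_one]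
    congr 1
    ext i
    have : (x i : ℂ) ≠ 0 := by exact_mod_cast (hx i).ne'
    simp [this]
  have cancel : ∀ M : Matrix (Fin n) (Fin n) ℂ, Uᴴ * (U * M) = M := fun M => by
    rw [← Matrix.mul_assoc, hU, Matrix.one_mul]
  have cancel' : ∀ M : Matrix (Fin n) (Fin n) ℂ, U * (Uᴴ * M) = M := fun M => by
    rw [← Matrix.mul_assoc, hU', Matrix.one_mul]
  have hXE : X⁻¹ = U * E * Uᴴ := by
    refine inv_eq_right_inv ?_
    rw [hXD]
    simp only [Matrix.mul_assoc, cancel]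
    rw [← Matrix.mul_assoc D, hDE, Matrix.one_mul, hU']
  have hY' : (Uᴴ * Y * U).PosDef :=
    hY.conjTranspose_mul_mul_same (mulVec_injective_of_isUnit hUu)
  have hG' : (Uᴴ * G * U).PosDef :=
    hG.conjTranspose_mul_mul_same (mulVec_injective_of_isUnit hUu)
  have key := sum_sq_mul_diag_le hx hY' hG' (by
    have : diagonal (fun i => (((x i)⁻¹ * (x i)⁻¹ : ℝ) : ℂ)) = E * E := by
      rw [hE, diagonal_mul_diagonal]; simp
    rw [this]
    have := congrArg (fun M => Uᴴ * M * U) h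
    simp only [hXE, Matrix.mul_assoc, cancel] at this
    simp only [Matrix.mul_assoc, cancel']
    exact this)
  have eG : (X * X * G).trace = (D * D * (Uᴴ * G * U)).trace := by
    rw [hXD]
    simp only [Matrix.mul_assoc, cancel]
    rw [trace_mul_comm]
    simp only [Matrix.mul_assoc]
  have eY : (X * X * X * Y).trace = (D * D * D * (Uᴴ * Y * U)).trace := by
    rw [hXD]
    simp only [Matrix.mul_assoc, cancel]
    rw [trace_mul_comm]
    simp only [Matrix.mul_assoc]
  rw [eG, eY]
  simp only [trace, diag_apply, hD, diagonal_mul_diagonal, diagonal_mul, ← Complex.ofReal_mul,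
    Complex.re_sum, Complex.re_ofReal_mul]
  convert key using 3 <;> ring

lemma hsNorm_le_of_pos_square_roots {T : Matrix (Fin n) (Fin n) ℂ} (hX : X.PosDef) (hY : Y.PosDef)
    (hT : T.PosDef) (h : X * T * T * X = Y * Y) {a b : ℝ} (ha : 0 ≤ a) (hb : 0 ≤ b) :
    hsNorm (a • (X * X + Y * Y) + b • (X * T * X)) ≤
      hsNorm (a • (X * X + Y * Y) + b • (X * Y)) := by
  have hG : (X * T * X).PosDef := by
    have := hT.mul_mul_conjTranspose_same (vecMul_injective_of_isUnit hX.isUnit)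
    rwa [hX.1.eq] at this
  have hXdet : IsUnit X.det := (isUnit_iff_isUnit_det X).1 hX.isUnit
  have hYdet : IsUnit Y.det := (isUnit_iff_isUnit_det Y).1 hY.isUnit
  have hTdet : IsUnit T.det := (isUnit_iff_isUnit_det T).1 hT.isUnit
  have h1 : Y * Y = (X * T * X) * (X⁻¹ * X⁻¹) * (X * T * X) := by
    simp only [← h, Matrix.mul_assoc, mul_nonsing_inv_cancel_left X _ hXdet,
      nonsing_inv_mul_cancel_left X _ hXdet]
  have h2 : X * X = (X * T * X) * (Y⁻¹ * Y⁻¹) * (X * T * X) := by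
    rw [← Matrix.mul_inv_rev, ← h]
    simp only [Matrix.mul_inv_rev, Matrix.mul_assoc, mul_nonsing_inv_cancel_left X _ hXdet,
      nonsing_inv_mul_cancel_left X _ hXdet, mul_nonsing_inv_cancel_left T _ hTdet,
      nonsing_inv_mul_cancel_left T _ hTdet]
  have k1 := re_trace_sq_mul_le hX hY hG h1
  have k2 := re_trace_sq_mul_le hY hX hG h2
  have k3 : ((X * T * X) * (X * T * X)).trace.re ≤ (Y * X * (X * Y)).trace.re := by
    have := re_trace_mul_self_le (T * (X * X))
    have e1 : (T * (X * X) * (T * (X * X))).trace = ((X * T * X) * (X * T * X)).trace := by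
      rw [← Matrix.mul_assoc, ← Matrix.mul_assoc, trace_mul_comm]
      simp only [Matrix.mul_assoc]
    have e2 : ((T * (X * X))ᴴ * (T * (X * X))).trace = (Y * X * (X * Y)).trace := by
      have : (T * (X * X))ᴴ * (T * (X * X)) = X * (Y * Y) * X := by
        rw [← h]
        simp only [conjTranspose_mul, hX.1.eq, hT.1.eq, Matrix.mul_assoc]
      rw [this, trace_mul_comm, ← Matrix.mul_assoc, ← Matrix.mul_assoc, trace_mul_comm]
      simp only [Matrix.mul_assoc]
    rwa [e1, e2] at this
  generalize X * T * X = G at hG k1 k2 k3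
  have cX := hX.1.eq
  have cY := hY.1.eq
  have hre : ∀ M : Matrix (Fin n) (Fin n) ℂ, Mᴴ.trace.re = M.trace.re := fun M => by
    simp [trace_conjTranspose]
  have expand : ∀ H : Matrix (Fin n) (Fin n) ℂ,
      ((a • (X * X + Y * Y) + b • H)ᴴ * (a • (X * X + Y * Y) + b • H)).trace.re
        = a ^ 2 * ((X * X + Y * Y) * (X * X + Y * Y)).trace.re
          + 2 * (a * b) * ((X * X * H).trace.re + (Y * Y * H).trace.re)
          + b ^ 2 * (Hᴴ * H).trace.re := fun H => by
    have e1 : (Hᴴ * (X * X + Y * Y)).trace.re = (X * X * H).trace.re + (Y * Y * H).trace.re := by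
      rw [← hre, conjTranspose_mul, conjTranspose_conjTranspose, conjTranspose_add,
        conjTranspose_mul, conjTranspose_mul, cX, cY, Matrix.add_mul, trace_add, Complex.add_re]
    have e2 : ((X * X + Y * Y) * H).trace.re = (X * X * H).trace.re + (Y * Y * H).trace.re := by
      rw [Matrix.add_mul, trace_add, Complex.add_re]
    simp only [conjTranspose_add, conjTranspose_smul, conjTranspose_mul, cX, cY, star_trivial]
    rw [Matrix.add_mul, Matrix.mul_add, Matrix.mul_add]
    simp only [Matrix.smul_mul, Matrix.mul_smul, trace_add, trace_smul, Complex.add_re,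
      Complex.smul_re, smul_eq_mul, e1, e2]
    ring
  refine Real.sqrt_le_sqrt ?_
  rw [expand, expand, hG.1.eq, conjTranspose_mul, cX, cY]
  have e1 : X * X * (X * Y) = X * X * X * Y := by simp only [Matrix.mul_assoc]
  have e2 : (Y * Y * (X * Y)).trace = (Y * Y * Y * X).trace := by
    rw [← Matrix.mul_assoc, trace_mul_comm]
    simp only [Matrix.mul_assoc]
  rw [e1, e2]
  have hab : 0 ≤ 2 * (a * b) := by positivity
  have := mul_le_mul_of_nonneg_left (add_le_add k1 k2) hab
  have := mul_le_mul_of_nonneg_left k3 (sq_nonneg b)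
  linarith

end

/-- `‖((1-s)/2)(A+B) + s(A♯B)‖₂ ≤ ‖((1-s)/2)(A+B) + s A^{1/2}B^{1/2}‖₂`. -/
theorem stmt_13 {n : ℕ} (A B : Matrix (Fin n) (Fin n) ℂ)
    (hA : A.PosDef) (hB : B.PosDef) (s : ℝ) (hs : s ∈ Set.Icc (0:ℝ) 1) :
    hsNorm (((1 - s) / 2) • (A + B) + s • geomMean A B (1/2)) ≤
      hsNorm (((1 - s) / 2) • (A + B) + s • (mpow A (1/2) * mpow B (1/2))) := by
  have hX := mpow_posDef hA (1/2)
  have hXX := mpow_half_mul_self hA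
  have hinv : mpow A (1/2) * mpow A (-(1/2)) = 1 := by
    rw [mpow_mul_mpow hA, add_neg_cancel, mpow_zero hA]
  have hinv' : mpow A (-(1/2)) * mpow A (1/2) = 1 := by
    rw [mpow_mul_mpow hA, neg_add_cancel, mpow_zero hA]
  have hY := mpow_posDef hB (1/2)
  have hYY := mpow_half_mul_self hB
  have hXi := mpow_posDef hA (-(1/2))
  have hC : (mpow A (-(1/2)) * B * mpow A (-(1/2))).PosDef := by
    have := hB.mul_mul_conjTranspose_same (vecMul_injective_of_isUnit hXi.isUnit)
    rwa [hXi.1.eq] at this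
  have hTT := mpow_half_mul_self hC
  have h : mpow A (1/2) * mpow (mpow A (-(1/2)) * B * mpow A (-(1/2))) (1/2) *
      mpow (mpow A (-(1/2)) * B * mpow A (-(1/2))) (1/2) * mpow A (1/2)
      = mpow B (1/2) * mpow B (1/2) := by
    rw [hYY, Matrix.mul_assoc (mpow A (1/2)), hTT]
    simp only [Matrix.mul_assoc, hinv', Matrix.mul_one]
    rw [← Matrix.mul_assoc, hinv, Matrix.one_mul]
  have key := hsNorm_le_of_pos_square_roots hX hY (mpow_posDef hC (1/2)) h
    (a := (1 - s) / 2) (b := s) (by linarith [hs.2]) hs.1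
  rwa [hXX, hYY] at key
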